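/- Let H be a closed subgroup of SL₂(ℝ) such that the homogeneous space SL₂(ℝ)/H carries an SL₂(ℝ)-invariant Borel probability measure (i.e., H has finite covolume). Then either H is a lattice in SL₂(ℝ) (H is discrete) or H = SL₂(ℝ). -/

import Mathlib

open MeasureTheory Matrix

noncomputable instance : TopologicalSpace (SpecialLinearGroup (Fin 2) ℝ) :=
  TopologicalSpace.induced (fun A => (A : Matrix (Fin 2) (Fin 2) ℝ)) inferInstance

section aux
open Filter Topology NormedSpace

local notation "SL2" => SpecialLinearGroup (Fin 2) ℝ
local notation "M2" => Matrix (Fin 2) (Fin 2) ℝ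

theorem sl2_isEmb : IsEmbedding (fun A : SL2 => (A : M2)) :=
  ⟨⟨rfl⟩, fun _ _ h => Subtype.ext h⟩

theorem sl2_closedEmb : IsClosedEmbedding (fun A : SL2 => (A : M2)) := by
  refine ⟨sl2_isEmb, ?_⟩
  have : Set.range (fun A : SL2 => (A : M2)) = {A : M2 | A.det = 1} := by
    ext A
    exact ⟨fun ⟨B, hB⟩ => hB ▸ B.2, fun h => ⟨⟨A, h⟩, rfl⟩⟩
  rw [this]
  exact isClosed_eq (Continuous.matrix_det continuous_id) continuous_const

instance sl2_topGroup : IsTopologicalGroup SL2 :=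
  @Matrix.SpecialLinearGroup.topologicalGroup (Fin 2) ℝ _ _ _ _ _

instance m2_secondCountable : SecondCountableTopology M2 :=
  inferInstanceAs (SecondCountableTopology (Fin 2 → Fin 2 → ℝ))

instance sl2_secondCountable : SecondCountableTopology SL2 :=
  sl2_isEmb.secondCountableTopology

theorem sl2_coe_inv (h : SL2) : ((h⁻¹ : SL2) : M2) = (h : M2)⁻¹ := by
  symm
  apply Matrix.inv_eq_right_inv
  exact congrArg Subtype.val (mul_inv_cancel h)

theorem sl2_coe_mul (h g : SL2) : ((h * g : SL2) : M2) = (h : M2) * (g : M2) := rfl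

theorem sl2_coe_zpow (g : SL2) (m : ℤ) : ((g ^ m : SL2) : M2) = (g : M2) ^ m := by
  cases m with
  | ofNat k => 
    simp only [Int.ofNat_eq_natCast, zpow_natCast]
    rfl
  | negSucc k =>
    rw [zpow_negSucc, zpow_negSucc, sl2_coe_inv]
    rfl

/-- Selberg property -/
theorem selberg (H : Subgroup SL2)
    [MeasurableSpace (SL2 ⧸ H)]
    [BorelSpace (SL2 ⧸ H)]
    (μ : Measure (SL2 ⧸ H)) [IsProbabilityMeasure μ]
    (hinv : ∀ g : SL2, Measure.map (fun x : SL2 ⧸ H => g • x) μ = μ) (a k : SL2) :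
    ∃ᶠ p : (SL2 × SL2) × ℕ in (𝓝 k ×ˢ 𝓝 k) ×ˢ atTop, p.1.2⁻¹ * a ^ p.2 * p.1.1 ∈ H := by
  have hpos : ∀ U : Set (SL2 ⧸ H), IsOpen U → U.Nonempty → μ U ≠ 0 := by
    intro U hU ⟨y, hy⟩ h0
    have : μ Set.univ = 0 := by
      apply measure_null_of_locally_null
      intro x _
      obtain ⟨g, hg⟩ := MulAction.exists_smul_eq SL2 x y
      have hc : Continuous (fun x : SL2 ⧸ H => g • x) := continuous_const_smul g
      refine ⟨(fun x : SL2 ⧸ H => g • x) ⁻¹' U, ?_, ?_⟩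
      · rw [nhdsWithin_univ]
        exact (hU.preimage hc).mem_nhds (by simpa [hg] using hy)
      · rw [← Measure.map_apply hc.measurable hU.measurableSet, hinv, h0]
    simp at this
  intro hev
  have hev' : ∀ᶠ p : (SL2 × SL2) × ℕ in (𝓝 k ×ˢ 𝓝 k) ×ˢ atTop,
    ¬ p.1.2⁻¹ * a ^ p.2 * p.1.1 ∈ H := hev
  rw [← nhds_prod_eq] at hev'
  obtain ⟨pa, hpa, pb, hpb, hab⟩ := Filter.eventually_prod_iff.1 hev'
  rw [nhds_prod_eq] at hpa
  obtain ⟨V, hV, hVp⟩ := Filter.eventually_prod_self_iff (r := fun x y => pa (x, y)) |>.1 hpa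
  obtain ⟨W, hWV, hWo, hkW⟩ := mem_nhds_iff.1 hV
  let U : Set (SL2 ⧸ H) := QuotientGroup.mk '' W
  have hUo : IsOpen U := QuotientGroup.isOpenMap_coe W hWo
  have hmp : MeasurePreserving (fun x : SL2 ⧸ H => a • x) μ μ :=
    ⟨(continuous_const_smul a).measurable, hinv a⟩
  have hfr := hmp.conservative.frequently_measure_inter_ne_zero
    hUo.measurableSet.nullMeasurableSet (hpos U hUo ⟨_, k, hkW, rfl⟩)
  obtain ⟨n, hn, hpn⟩ := (hfr.and_eventually hpb).exists
  obtain ⟨x, hx1, hx2⟩ := nonempty_of_measure_ne_zero hn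
  obtain ⟨u, hu, rfl⟩ := hx1
  obtain ⟨v, hv, hvx⟩ := hx2
  rw [smul_iterate] at hvx
  refine hab (x := (u, v)) (hVp u (hWV hu) v (hWV hv)) hpn ?_
  have : (QuotientGroup.mk v : SL2 ⧸ H) = QuotientGroup.mk (a ^ n * u) := hvx
  rw [QuotientGroup.eq] at this
  simpa [mul_assoc] using this

/-- the Lie algebra -/
def lieSet (H : Subgroup SL2) : Set M2 :=
  {X | ∀ t : ℝ, exp (t • X) ∈ (fun A : SL2 => (A : M2)) '' H}

attribute [local instance] Matrix.linftyOpNormedRing Matrix.linftyOpNormedAlgebra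

theorem m2_exp_cont : Continuous (exp : M2 → M2) := NormedSpace.exp_continuous

theorem lieSet_closed (H : Subgroup SL2) (hH : IsClosed (H : Set SL2)) :
    IsClosed (lieSet H) := by
  have h1 := sl2_closedEmb.isClosedMap _ hH
  have : lieSet H = ⋂ t : ℝ, (fun X : M2 => exp (t • X)) ⁻¹' ((fun A : SL2 => (A : M2)) '' H) := by
    ext X; simp [lieSet]
  rw [this]
  exact isClosed_iInter fun t => h1.preimage (m2_exp_cont.comp (continuous_const_smul t))

theorem lieSet_smul (H : Subgroup SL2) {X : M2} (hX : X ∈ lieSet H) (c : ℝ) :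
    c • X ∈ lieSet H := fun t => by
  rw [smul_smul]; exact hX _

theorem lieSet_conj (H : Subgroup SL2) {X : M2} (hX : X ∈ lieSet H) (h : SL2) (hh : h ∈ H) :
    (h : M2) * X * ((h⁻¹ : SL2) : M2) ∈ lieSet H := fun t => by
  obtain ⟨g, hg, hgX⟩ := hX t
  refine ⟨h * g * h⁻¹, H.mul_mem (H.mul_mem hh hg) (H.inv_mem hh), ?_⟩
  have hinv := sl2_coe_inv h
  have hu : IsUnit (h : M2) := by
    rw [Matrix.isUnit_iff_isUnit_det]; simp
  have := Matrix.exp_conj (h : M2) (t • X) hu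
  rw [hinv, ← smul_mul_assoc, ← mul_smul_comm, this]
  rw [← hgX, ← hinv]
  rfl

theorem exists_lie (H : Subgroup SL2) (hH : IsClosed (H : Set SL2))
    (hd : ¬ DiscreteTopology H) : ∃ X ∈ lieSet H, X ≠ 0 := by
  set HM : Set M2 := (fun A : SL2 => (A : M2)) '' H with hHM
  have h1 : ∃ᶠ x : M2 in 𝓝 1, x ∈ HM ∧ x ≠ 1 := by
    intro hev
    apply hd
    apply discreteTopology_of_isOpen_singleton_one
    have hc : Continuous (fun x : H => ((x : SL2) : M2)) :=
      sl2_isEmb.continuous.comp continuous_subtype_val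
    rw [isOpen_singleton_iff_nhds_eq_pure, ← Filter.principal_singleton]
    apply le_antisymm _ (by simpa using pure_le_nhds (1 : H))
    rw [le_principal_iff]
    have h2 : Tendsto (fun x : H => ((x : SL2) : M2)) (𝓝 1) (𝓝 1) := by
      simpa using hc.tendsto 1
    filter_upwards [h2.eventually hev] with x hx
    by_contra hne
    apply hx
    refine ⟨⟨x, x.2, rfl⟩, fun h => hne ?_⟩
    apply Subtype.ext
    apply Subtype.ext
    simpa using h
  have hmap : map (exp : M2 → M2) (𝓝 0) = 𝓝 1 := by
    have := (hasStrictFDerivAt_exp_zero (𝕂 := ℝ) (𝔸 := M2))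
    have h3 := HasStrictFDerivAt.map_nhds_eq_of_equiv
      (f' := ContinuousLinearEquiv.refl ℝ M2) this
    rw [exp_zero] at h3
    exact h3
  rw [← hmap, Filter.frequently_map] at h1
  obtain ⟨X, hX, hXe⟩ := mem_closure_iff_seq_limit.1 (mem_closure_iff_frequently.2 h1)
  have hX0 : ∀ n, X n ≠ 0 := fun n h => (hX n).2 (by simp [h])
  have hXn : ∀ n, 0 < ‖X n‖ := fun n => norm_pos_iff.2 (hX0 n)
  have hsph : ∀ n, (‖X n‖)⁻¹ • X n ∈ Metric.sphere (0 : M2) 1 := fun n => by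
    simp [norm_smul, (hXn n).ne']
  have : ProperSpace M2 := FiniteDimensional.proper ℝ M2
  obtain ⟨Y, hY, φ, hφ, hlim⟩ := (isCompact_sphere (0 : M2) 1).tendsto_subseq hsph
  refine ⟨Y, ?_, ?_⟩
  · intro t
    have hcl := sl2_closedEmb.isClosedMap _ hH
    let m : ℕ → ℤ := fun n => ⌊t / ‖X (φ n)‖⌋
    have hn0 : Tendsto (fun n => ‖X (φ n)‖) atTop (𝓝 0) := by
      simpa using (hXe.comp hφ.tendsto_atTop).norm
    have hm : Tendsto (fun n => (m n : ℝ) * ‖X (φ n)‖) atTop (𝓝 t) := by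
      have hlow : Tendsto (fun n => t - ‖X (φ n)‖) atTop (𝓝 t) := by
        simpa using hn0.const_sub t
      refine tendsto_of_tendsto_of_tendsto_of_le_of_le hlow tendsto_const_nhds ?_ ?_
      · intro n
        have h := Int.lt_floor_add_one (t / ‖X (φ n)‖)
        rw [div_lt_iff₀ (hXn _)] at h
        simp only [m]
        linarith
      · intro n
        have h := Int.floor_le (t / ‖X (φ n)‖)
        rw [le_div_iff₀ (hXn _)] at h
        exact h
    have h4 : Tendsto (fun n => exp (m n • X (φ n))) atTop (𝓝 (exp (t • Y))) := by
      refine (m2_exp_cont.tendsto _).comp ?_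
      refine (hm.smul hlim).congr fun n => ?_
      simp only [Function.comp]
      rw [smul_smul, mul_assoc, mul_inv_cancel₀ (hXn _).ne', mul_one, Int.cast_smul_eq_zsmul]
    refine hcl.mem_of_tendsto h4 (Eventually.of_forall fun n => ?_)
    obtain ⟨g, hg, hgX⟩ := (hX (φ n)).1
    refine ⟨g ^ (m n), H.zpow_mem hg _, ?_⟩
    rw [Matrix.exp_zsmul, ← hgX]
    exact sl2_coe_zpow g (m n)
  · rintro rfl
    simp at hY

theorem exp_sq_zero (N : M2) (hN : N * N = 0) : exp N = 1 + N := by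
  rw [exp_eq_tsum ℝ]
  simp only
  rw [tsum_eq_sum (s := Finset.range 2)]
  · simp [Finset.sum_range_succ]
  · intro n hn
    have : 2 ≤ n := by simp at hn; omega
    obtain ⟨j, rfl⟩ := Nat.exists_eq_add_of_le this
    rw [pow_add, pow_two, hN]; simp

theorem m2_entry_cont (i j : Fin 2) : Continuous (fun M : M2 => M i j) :=
  continuous_id.matrix_elem i j

/-- the contracting family -/
def dmap (c : ℝ) (M : M2) : M2 := !![c * M 0 0, M 0 1; c ^ 2 * M 1 0, c * M 1 1]

theorem dmap_cont : Continuous (fun p : ℝ × M2 => dmap p.1 p.2) := by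
  refine continuous_matrix fun i j => ?_
  have h : ∀ i j : Fin 2, Continuous (fun p : ℝ × M2 => p.2 i j) := fun i j =>
    (m2_entry_cont i j).comp continuous_snd
  have h1 : Continuous (fun p : ℝ × M2 => p.1) := continuous_fst
  fin_cases i <;> fin_cases j
  · exact h1.mul (h 0 0)
  · exact h 0 1
  · exact (h1.pow 2).mul (h 1 0)
  · exact h1.mul (h 1 1)

/-- the diagonal element -/
noncomputable def diagA : SL2 := ⟨!![2, 0; 0, 1/2], by simp [Matrix.det_fin_two]⟩

theorem diagA_pow (n : ℕ) : ((diagA ^ n : SL2) : M2) = !![2 ^ n, 0; 0, (1/2) ^ n] := by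
  induction n with
  | zero => ext i j; fin_cases i <;> fin_cases j <;> rfl
  | succ n ih =>
    rw [pow_succ, sl2_coe_mul, ih]
    change _ * !![(2:ℝ), 0; 0, 1/2] = _
    ext i j; fin_cases i <;> fin_cases j <;> simp [Matrix.mul_apply, pow_succ]

theorem diagA_pow_inv (n : ℕ) :
    (((diagA ^ n)⁻¹ : SL2) : M2) = !![(1/2) ^ n, 0; 0, 2 ^ n] := by
  rw [Matrix.SpecialLinearGroup.coe_inv, diagA_pow, Matrix.adjugate_fin_two]
  simp

theorem dmap_eq (n : ℕ) (M : M2) :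
    dmap ((1/4) ^ n) M =
      ((1/4 : ℝ) ^ n) • (((diagA ^ n : SL2) : M2) * M * (((diagA ^ n)⁻¹ : SL2) : M2)) := by
  rw [diagA_pow, diagA_pow_inv]
  have e1 : (1/4 : ℝ) ^ n * 2 ^ n * 2 ^ n = 1 := by
    rw [← mul_pow, ← mul_pow]; norm_num
  have e2 : (1/2 : ℝ) ^ n * 2 ^ n = 1 := by
    rw [← mul_pow]; norm_num
  have e3 : (1/4 : ℝ) ^ n = (1/2) ^ n * (1/2) ^ n := by
    rw [← mul_pow]; norm_num
  generalize (1/4 : ℝ) ^ n = c at *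
  generalize (1/2 : ℝ) ^ n = b at *
  generalize (2 : ℝ) ^ n = d at *
  obtain ⟨p, q, r, t, rfl⟩ : ∃ p q r t, M = !![p, q; r, t] := ⟨_, _, _, _, Matrix.eta_fin_two M⟩
  rw [Matrix.mul_fin_two, Matrix.mul_fin_two]
  ext i j
  fin_cases i <;> fin_cases j <;> simp [dmap, -mul_eq_mul_left_iff]
  · linear_combination (-c * p) * e2
  · linear_combination (-q) * e1
  · rw [e3]; ring
  · linear_combination (-c * t) * e2

theorem limit_mem (H : Subgroup SL2) (hH : IsClosed (H : Set SL2)) (k : SL2)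
    (hS : ∃ᶠ p : (SL2 × SL2) × ℕ in (𝓝 k ×ˢ 𝓝 k) ×ˢ atTop,
      p.1.2⁻¹ * diagA ^ p.2 * p.1.1 ∈ H) {X : M2} (hX : X ∈ lieSet H) :
    ((k⁻¹ : SL2) : M2) * dmap 0 ((k : M2) * X * ((k⁻¹ : SL2) : M2)) * (k : M2) ∈ lieSet H := by
  let Φ : (SL2 × SL2) × ℝ → M2 := fun p =>
    ((p.1.2⁻¹ : SL2) : M2) * dmap p.2 ((p.1.1 : M2) * X * ((p.1.1⁻¹ : SL2) : M2)) * (p.1.2 : M2)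
  have hc : Continuous (fun A : SL2 => (A : M2)) := sl2_isEmb.continuous
  have hu : Continuous (fun p : (SL2 × SL2) × ℝ => p.1.1) := continuous_fst.comp continuous_fst
  have hv : Continuous (fun p : (SL2 × SL2) × ℝ => p.1.2) := continuous_snd.comp continuous_fst
  have hΦ : Continuous Φ := by
    have h1 : Continuous (fun p : (SL2 × SL2) × ℝ =>
      (p.1.1 : M2) * X * ((p.1.1⁻¹ : SL2) : M2)) :=
      ((hc.comp hu).mul continuous_const).mul (hc.comp hu.inv)
    exact ((hc.comp hv.inv).mul (dmap_cont.comp (continuous_snd.prodMk h1))).mul (hc.comp hv)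
  have hpow : Tendsto (fun n : ℕ => (1/4 : ℝ) ^ n) atTop (𝓝 0) :=
    tendsto_pow_atTop_nhds_zero_of_lt_one (by norm_num) (by norm_num)
  have hT : Tendsto (fun p : (SL2 × SL2) × ℕ => Φ (p.1, (1/4 : ℝ) ^ p.2))
      ((𝓝 k ×ˢ 𝓝 k) ×ˢ atTop) (𝓝 (Φ ((k, k), 0))) := by
    refine (hΦ.tendsto _).comp ?_
    rw [nhds_prod_eq, nhds_prod_eq]
    exact (tendsto_id.prodMap hpow)
  refine (lieSet_closed H hH).mem_of_frequently_of_tendsto (hS.mono ?_) hT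
  rintro ⟨⟨u, v⟩, n⟩ hp
  have h2 := lieSet_smul H (lieSet_conj H hX _ hp) ((1/4 : ℝ) ^ n)
  convert h2 using 1
  simp only [Φ, dmap_eq, _root_.mul_inv_rev, inv_inv, sl2_coe_mul, mul_smul_comm, smul_mul_assoc,
    Matrix.mul_assoc]

/-- upper elementary -/
def upE (s : ℝ) : SL2 := ⟨!![1, s; 0, 1], by simp [Matrix.det_fin_two]⟩
/-- lower elementary -/
def loE (s : ℝ) : SL2 := ⟨!![1, 0; s, 1], by simp [Matrix.det_fin_two]⟩

/-- a Weyl-type element -/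
def wE : SL2 := ⟨!![1, 1; -1, 0], by simp [Matrix.det_fin_two]⟩

theorem sl2_gen (H : Subgroup SL2) (hu : ∀ s, upE s ∈ H) (hl : ∀ s, loE s ∈ H) : H = ⊤ := by
  have key : ∀ A : SL2, (A : M2) 1 0 ≠ 0 → A ∈ H := by
    intro A hA
    have hdet : (A : M2) 0 0 * (A : M2) 1 1 - (A : M2) 0 1 * (A : M2) 1 0 = 1 := by
      rw [← Matrix.det_fin_two]; exact A.2
    have : A = upE (((A : M2) 0 0 - 1) / (A : M2) 1 0) * loE ((A : M2) 1 0) *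
        upE (((A : M2) 1 1 - 1) / (A : M2) 1 0) := by
      apply Subtype.ext
      rw [sl2_coe_mul, sl2_coe_mul]
      simp only [upE, loE]
      ext i j
      fin_cases i <;> fin_cases j <;> simp [Matrix.mul_apply, Fin.sum_univ_two] <;> field_simp
      · ring
      · linear_combination -hdet
      · ring
    rw [this]
    exact H.mul_mem (H.mul_mem (hu _) (hl _)) (hu _)
  rw [Subgroup.eq_top_iff']
  intro A
  by_cases hA : (A : M2) 1 0 = 0
  · have hdet : (A : M2) 0 0 * (A : M2) 1 1 - (A : M2) 0 1 * (A : M2) 1 0 = 1 := by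
      rw [← Matrix.det_fin_two]; exact A.2
    have h1 : loE 1 * A ∈ H := by
      apply key
      rw [sl2_coe_mul]
      simp only [loE]
      simp [Matrix.mul_apply, Fin.sum_univ_two, hA]
      intro h
      simp [hA, h] at hdet
    simpa using H.mul_mem (H.inv_mem (hl 1)) h1
  · exact key A hA

theorem lie_not_scalar (H : Subgroup SL2) {X : M2} (hX : X ∈ lieSet H) (h0 : X ≠ 0)
    (h01 : X 0 1 = 0) (h10 : X 1 0 = 0) (hd : X 0 0 = X 1 1) : False := by
  have hXd : X = Matrix.diagonal (fun _ => X 0 0) := by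
    ext i j; fin_cases i <;> fin_cases j <;> simp [h01, h10, hd]
  obtain ⟨g, -, hg⟩ := hX 1
  have hdet : (exp ((1 : ℝ) • X)).det = 1 := by rw [← hg]; exact g.2
  have hpi : ∀ i : Fin 2, exp (fun _ : Fin 2 => X 0 0) i = Real.exp (X 0 0) := fun i => by
    rw [Real.exp_eq_exp_ℝ]; exact Pi.coe_exp _ i
  rw [one_smul, hXd, Matrix.exp_diagonal, Matrix.det_diagonal] at hdet
  simp only [Fin.prod_univ_two, hpi, ← Real.exp_add] at hdet
  rw [Real.exp_eq_one_iff] at hdet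
  apply h0
  rw [hXd]
  have : X 0 0 = 0 := by linarith
  simp [this]

theorem up_mem (H : Subgroup SL2) (c : ℝ) (hc : c ≠ 0) (h : !![0, c; 0, 0] ∈ lieSet H) (s : ℝ) :
    upE s ∈ H := by
  obtain ⟨g, hg, hgs⟩ := h (s / c)
  rw [exp_sq_zero _ (by ext i j; fin_cases i <;> fin_cases j <;>
    simp [Matrix.mul_apply])] at hgs
  have : g = upE s := by
    apply Subtype.ext
    refine hgs.trans ?_
    simp only [upE]
    ext i j
    fin_cases i <;> fin_cases j <;> simp [hc]
  exact this ▸ hg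

theorem lo_mem (H : Subgroup SL2) (c : ℝ) (hc : c ≠ 0) (h : !![0, 0; c, 0] ∈ lieSet H) (s : ℝ) :
    loE s ∈ H := by
  obtain ⟨g, hg, hgs⟩ := h (s / c)
  rw [exp_sq_zero _ (by ext i j; fin_cases i <;> fin_cases j <;>
    simp [Matrix.mul_apply])] at hgs
  have : g = loE s := by
    apply Subtype.ext
    refine hgs.trans ?_
    simp only [loE]
    ext i j
    fin_cases i <;> fin_cases j <;> simp [hc]
  exact this ▸ hg

theorem exists_up (X : M2) (h : ¬ (X 0 1 = 0 ∧ X 1 0 = 0 ∧ X 0 0 = X 1 1)) :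
    ∃ s : ℝ, X 0 1 + s * (X 1 1 - X 0 0) - s ^ 2 * X 1 0 ≠ 0 := by
  by_contra! hs
  have a := hs 0
  have b := hs 1
  have c := hs (-1)
  exact h ⟨by linarith, by linarith, by linarith⟩

theorem main_aux (H : Subgroup SL2) (hH : IsClosed (H : Set SL2))
    (hS : ∀ k : SL2, ∃ᶠ p : (SL2 × SL2) × ℕ in (𝓝 k ×ˢ 𝓝 k) ×ˢ atTop,
      p.1.2⁻¹ * diagA ^ p.2 * p.1.1 ∈ H) (hd : ¬ DiscreteTopology H) : H = ⊤ := by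
  obtain ⟨X, hX, hX0⟩ := exists_lie H hH hd
  obtain ⟨s, hs⟩ := exists_up X fun ⟨h1, h2, h3⟩ => lie_not_scalar H hX hX0 h1 h2 h3
  have hU := limit_mem H hH (upE s) (hS _) hX
  have hU' : !![0, X 0 1 + s * (X 1 1 - X 0 0) - s ^ 2 * X 1 0; 0, 0] ∈ lieSet H := by
    convert hU using 1
    rw [Matrix.SpecialLinearGroup.coe_inv, Matrix.adjugate_fin_two]
    ext i j
    fin_cases i <;> fin_cases j <;>
      simp [upE, dmap, Matrix.mul_apply, Fin.sum_univ_two, Matrix.vecMul, dotProduct]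
    ring
  have hL := limit_mem H hH wE (hS _) hU'
  generalize X 0 1 + s * (X 1 1 - X 0 0) - s ^ 2 * X 1 0 = c at hs hU' hL
  refine sl2_gen H (up_mem H c hs hU') (lo_mem H (-c) (neg_ne_zero.2 hs) ?_)
  convert hL using 1
  rw [Matrix.SpecialLinearGroup.coe_inv, Matrix.adjugate_fin_two]
  ext i j
  fin_cases i <;> fin_cases j <;>
    simp [wE, dmap, Matrix.mul_apply, Fin.sum_univ_two, Matrix.vecMul, dotProduct]

end aux

/-- Borel density theorem for `SL₂(ℝ)`: a closed subgroup of finite covolume (i.e. such that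
the homogeneous space carries an invariant Borel probability measure) is either a lattice
(a discrete subgroup) or the whole group. -/
theorem stmt7 (H : Subgroup (SpecialLinearGroup (Fin 2) ℝ))
    (hH : IsClosed (H : Set (SpecialLinearGroup (Fin 2) ℝ)))
    [MeasurableSpace (SpecialLinearGroup (Fin 2) ℝ ⧸ H)]
    [BorelSpace (SpecialLinearGroup (Fin 2) ℝ ⧸ H)]
    (μ : Measure (SpecialLinearGroup (Fin 2) ℝ ⧸ H)) [IsProbabilityMeasure μ]
    (hinv : ∀ g : SpecialLinearGroup (Fin 2) ℝ,
      Measure.map (fun x : SpecialLinearGroup (Fin 2) ℝ ⧸ H => g • x) μ = μ) :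
    DiscreteTopology H ∨ H = ⊤ := by
  by_cases hd : DiscreteTopology H
  · exact Or.inl hd
  · exact Or.inr (main_aux H hH (selberg H μ hinv diagA) hd)
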